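/- In the skew field of fractions of the quantum torus ℤ[q^{±1/2}]⟨X₁^{±1}, X₂^{±1} : X₁X₂ = qX₂X₁⟩, the sequence (X_m)_{m∈ℤ} defined by the initial values X₁, X₂ and the recursion X_{m-1} X_{m+1} = q X_m² + 1 satisfies: every X_m is well-defined (i.e., nonzero at each step so the recursion can be inverted in both directions). -/

import Mathlib

namespace QuantumKronecker

section QCommuting

variable {K : Type*} [Field K] {F : Type*} [DivisionRing F] [Algebra K F]

/-- Semiconjugation up to a scalar is inherited by integer powers. -/
theorem exists_mul_zpow_eq_smul {x y : F} {c : K} (h : x * y = c • (y * x)) (b : ℤ) :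
    x * y ^ b = c ^ b • (y ^ b * x) := by
  have hs : SemiconjBy x y (algebraMap K F c * y) := by
    rw [SemiconjBy, h, Algebra.smul_def, mul_assoc]
  have := (hs.zpow_right₀ b).eq
  have hc : Commute (algebraMap K F c) y := Algebra.commutes c y
  rwa [hc.mul_zpow, ← map_zpow₀, mul_assoc,
    ← Algebra.smul_def] at this

theorem exists_zpow_mul_zpow_eq_smul {q : K} (hq : q ≠ 0) {x y : F}
    (h : x * y = q • (y * x)) (b d : ℤ) :
    ∃ c : K, y ^ b * x ^ d = c • (x ^ d * y ^ b) := by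
  refine ⟨((q ^ b)⁻¹) ^ d, exists_mul_zpow_eq_smul ?_ d⟩
  rw [exists_mul_zpow_eq_smul h b, smul_smul, inv_mul_cancel₀ (zpow_ne_zero b hq), one_smul]

variable (K) in
/-- The span of the monomials `x ^ a * y ^ b` whose total degree `a + b` lies in `S`. -/
def degreeSpan (x y : F) (S : Set ℤ) : Submodule K F :=
  Submodule.span K ((fun ab : ℤ × ℤ => x ^ ab.1 * y ^ ab.2) '' {ab | ab.1 + ab.2 ∈ S})

theorem zpow_mul_zpow_mem_degreeSpan {x y : F} {S : Set ℤ} {a b : ℤ} (h : a + b ∈ S) :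
    x ^ a * y ^ b ∈ degreeSpan K x y S :=
  Submodule.subset_span ⟨(a, b), h, rfl⟩

theorem degreeSpan_mono {x y : F} {S T : Set ℤ} (h : S ⊆ T) :
    degreeSpan K x y S ≤ degreeSpan K x y T :=
  Submodule.span_mono (Set.image_mono fun _ hab => h hab)

theorem mul_mem_degreeSpan {q : K} (hq : q ≠ 0) {x y : F} (h : x * y = q • (y * x))
    (hx : x ≠ 0) (hy : y ≠ 0) {S T U : Set ℤ} (hU : ∀ s ∈ S, ∀ t ∈ T, s + t ∈ U)
    {u v : F} (hu : u ∈ degreeSpan K x y S) (hv : v ∈ degreeSpan K x y T) :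
    u * v ∈ degreeSpan K x y U := by
  have hmul := Submodule.mul_mem_mul hu hv
  rw [degreeSpan, degreeSpan, Submodule.span_mul_span] at hmul
  refine Submodule.span_le.2 ?_ hmul
  rintro _ ⟨_, ⟨⟨a, b⟩, hab, rfl⟩, _, ⟨⟨d, e⟩, hde, rfl⟩, rfl⟩
  obtain ⟨c, hc⟩ := exists_zpow_mul_zpow_eq_smul hq h b d
  have key : x ^ a * y ^ b * (x ^ d * y ^ e) = c • (x ^ (a + d) * y ^ (b + e)) := by
    rw [mul_assoc, ← mul_assoc (y ^ b), hc, zpow_add₀ hx, zpow_add₀ hy]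
    simp only [smul_mul_assoc, mul_smul_comm, mul_assoc]
  simp only [key, SetLike.mem_coe]
  refine Submodule.smul_mem _ _ (zpow_mul_zpow_mem_degreeSpan ?_)
  have := hU _ hab _ hde
  rwa [add_add_add_comm] at this

theorem add_ne_zero_of_mem_degreeSpan {x y : F}
    (hind : LinearIndependent K (fun ab : ℤ × ℤ => x ^ ab.1 * y ^ ab.2)) {S T : Set ℤ}
    (hST : Disjoint S T) {u v : F} (hu : u ∈ degreeSpan K x y S) (hu0 : u ≠ 0)
    (hv : v ∈ degreeSpan K x y T) : u + v ≠ 0 := by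
  intro h
  have hdisj : Disjoint (degreeSpan K x y S) (degreeSpan K x y T) :=
    hind.disjoint_span_image (Disjoint.preimage (fun ab : ℤ × ℤ => ab.1 + ab.2) hST)
  refine hu0 (Submodule.disjoint_def.1 hdisj u hu ?_)
  rw [eq_neg_of_add_eq_zero_left h]
  exact neg_mem hv

end QCommuting

section Recursion

variable {K : Type*} [Field K] {F : Type*} [DivisionRing F] [Algebra K F]

/-- The quantity `x⁻¹y + y⁻¹x⁻¹ + q⁻¹y⁻¹x` conserved by the Kronecker recursion. -/
def conserved (q : K) (x y : F) : F :=
  x⁻¹ * y + y⁻¹ * x⁻¹ + q⁻¹ • (y⁻¹ * x)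

/-- The linearised recursion `X (n + 2) = X (n + 1) * H - q⁻¹ X n`, started at `x`, `y`. -/
def linearSeq (q : K) (x y : F) : ℕ → F
  | 0 => x
  | 1 => y
  | n + 2 => linearSeq q x y (n + 1) * conserved q x y - q⁻¹ • linearSeq q x y n

theorem left_mem_degreeSpan (x y : F) : x ∈ degreeSpan K x y {1} := by
  simpa using zpow_mul_zpow_mem_degreeSpan (K := K) (x := x) (y := y) (S := {1})
    (a := 1) (b := 0) (by simp)

theorem right_mem_degreeSpan (x y : F) : y ∈ degreeSpan K x y {1} := by
  simpa using zpow_mul_zpow_mem_degreeSpan (K := K) (x := x) (y := y) (S := {1})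
    (a := 0) (b := 1) (by simp)

theorem left_inv_mem_degreeSpan (x y : F) : x⁻¹ ∈ degreeSpan K x y {-1} := by
  simpa using zpow_mul_zpow_mem_degreeSpan (K := K) (x := x) (y := y) (S := {-1})
    (a := -1) (b := 0) (by simp)

theorem right_inv_mem_degreeSpan (x y : F) : y⁻¹ ∈ degreeSpan K x y {-1} := by
  simpa using zpow_mul_zpow_mem_degreeSpan (K := K) (x := x) (y := y) (S := {-1})
    (a := 0) (b := -1) (by simp)

theorem inv_mul_inv_mem_degreeSpan {q : K} (hq : q ≠ 0) {x y : F} (hx : x ≠ 0)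
    (hy : y ≠ 0) (h : x * y = q • (y * x)) :
    y⁻¹ * x⁻¹ ∈ degreeSpan K x y {-2} :=
  mul_mem_degreeSpan hq h hx hy (by simp) (right_inv_mem_degreeSpan x y)
    (left_inv_mem_degreeSpan x y)

theorem mul_pow_mem_degreeSpan {q : K} (hq : q ≠ 0) {x y : F} (hx : x ≠ 0)
    (hy : y ≠ 0) (h : x * y = q • (y * x)) (k : ℕ) :
    y * (y⁻¹ * x⁻¹) ^ k ∈ degreeSpan K x y {1 - 2 * (k : ℤ)} := by
  induction k with
  | zero => simpa using right_mem_degreeSpan (K := K) x y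
  | succ k ih =>
    rw [pow_succ, ← mul_assoc]
    refine mul_mem_degreeSpan hq h hx hy ?_ ih (inv_mul_inv_mem_degreeSpan hq hx hy h)
    simp only [Set.mem_singleton_iff]
    push_cast
    grind

/-- The leading term of `linearSeq` is a monomial whose degree decreases by two at each step. -/
theorem exists_linearSeq_eq_add {q : K} (hq : q ≠ 0) {x y : F} (hx : x ≠ 0)
    (hy : y ≠ 0) (h : x * y = q • (y * x)) (k : ℕ) :
    (∃ v ∈ degreeSpan K x y (Set.Ioi (1 - 2 * (k : ℤ))),
      linearSeq q x y (k + 1) = y * (y⁻¹ * x⁻¹) ^ k + v) ∧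
    linearSeq q x y k ∈ degreeSpan K x y (Set.Ioi (-1 - 2 * (k : ℤ))) := by
  induction k with
  | zero =>
    exact ⟨⟨0, zero_mem _, by simp [linearSeq]⟩,
      degreeSpan_mono (by simp) (left_mem_degreeSpan x y)⟩
  | succ k ih =>
    obtain ⟨⟨v, hv, hk⟩, hprev⟩ := ih
    have hlead := mul_pow_mem_degreeSpan hq hx hy h k
    have hP := inv_mul_inv_mem_degreeSpan hq hx hy h
    have hr : x⁻¹ * y + q⁻¹ • (y⁻¹ * x) ∈ degreeSpan K x y {0} :=
      add_mem
        (mul_mem_degreeSpan hq h hx hy (by simp) (left_inv_mem_degreeSpan x y)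
          (right_mem_degreeSpan x y))
        (Submodule.smul_mem _ _ (mul_mem_degreeSpan hq h hx hy (by simp)
          (right_inv_mem_degreeSpan x y) (left_mem_degreeSpan x y)))
    have hH : conserved q x y = y⁻¹ * x⁻¹ + (x⁻¹ * y + q⁻¹ • (y⁻¹ * x)) := by
      rw [conserved]; abel
    have hHmem : conserved q x y ∈ degreeSpan K x y (Set.Ici (-2)) := by
      rw [hH]
      exact add_mem (degreeSpan_mono (by simp) hP) (degreeSpan_mono (by simp) hr)
    refine ⟨⟨y * (y⁻¹ * x⁻¹) ^ k * (x⁻¹ * y + q⁻¹ • (y⁻¹ * x)) + v * conserved q x y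
      - q⁻¹ • linearSeq q x y k, ?_, ?_⟩, ?_⟩
    · refine sub_mem (add_mem ?_ ?_) (Submodule.smul_mem _ _ ?_)
      · refine mul_mem_degreeSpan hq h hx hy ?_ hlead hr
        simp only [Set.mem_singleton_iff, Set.mem_Ioi]
        push_cast
        grind
      · refine mul_mem_degreeSpan hq h hx hy ?_ hv hHmem
        simp only [Set.mem_Ici, Set.mem_Ioi]
        push_cast
        grind
      · refine degreeSpan_mono (Set.Ioi_subset_Ioi ?_) hprev
        push_cast
        linarith
    · rw [linearSeq, hk, pow_succ, add_mul, add_sub_assoc, ← mul_assoc y]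
      nth_rw 1 [hH]
      rw [mul_add]
      abel
    · rw [hk]
      refine add_mem (degreeSpan_mono ?_ hlead) (degreeSpan_mono (Set.Ioi_subset_Ioi ?_) hv)
      · simp only [Set.singleton_subset_iff, Set.mem_Ioi]
        push_cast
        linarith
      · push_cast
        linarith

theorem linearSeq_ne_zero {q : K} (hq : q ≠ 0) {x y : F} (hx : x ≠ 0)
    (hy : y ≠ 0) (h : x * y = q • (y * x))
    (hind : LinearIndependent K (fun ab : ℤ × ℤ => x ^ ab.1 * y ^ ab.2)) (k : ℕ) :
    linearSeq q x y k ≠ 0 := by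
  cases k with
  | zero => exact hx
  | succ k =>
    obtain ⟨v, hv, hk⟩ := (exists_linearSeq_eq_add hq hx hy h k).1
    rw [hk]
    exact add_ne_zero_of_mem_degreeSpan hind (by simp)
      (mul_pow_mem_degreeSpan hq hx hy h k)
      (mul_ne_zero hy (pow_ne_zero _ (mul_ne_zero (inv_ne_zero hy) (inv_ne_zero hx)))) hv

/-- One step of the linear recursion preserves both the exchange relation and
the quasi-commutation relation. -/
theorem exchange_step {q : K} (hq : q ≠ 0) {u v w H : F} (hu : u ≠ 0)
    (huv : u * v = q • (v * u)) (huw : u * w = q • v ^ 2 + 1)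
    (hw : w = v * H - q⁻¹ • u) :
    v * w = q • (w * v) ∧ v * (w * H - q⁻¹ • v) = q • w ^ 2 + 1 := by
  have hvw : v * w = q • (w * v) := by
    refine mul_left_cancel₀ hu ?_
    rw [← mul_assoc, huv, smul_mul_assoc, mul_assoc, huw, mul_smul_comm, ← mul_assoc, huw]
    simp only [mul_add, add_mul, mul_smul_comm, smul_mul_assoc, mul_one, one_mul, pow_two,
      mul_assoc]
  have hwu : w * u = q⁻¹ • v ^ 2 + 1 := by
    refine mul_left_cancel₀ hu ?_
    have huvv : u * v ^ 2 = (q * q) • (v ^ 2 * u) := by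
      rw [pow_two, ← mul_assoc, huv, smul_mul_assoc, mul_assoc, huv, mul_smul_comm, smul_smul,
        mul_assoc]
    rw [← mul_assoc, huw, mul_add, mul_smul_comm, huvv, smul_smul, add_mul, smul_mul_assoc,
      inv_mul_cancel_left₀ hq, one_mul, mul_one]
  have hvH : v * H = w + q⁻¹ • u := by rw [hw]; abel
  refine ⟨hvw, ?_⟩
  calc v * (w * H - q⁻¹ • v) = q • (w * (v * H)) - q⁻¹ • v ^ 2 := by
        rw [mul_sub, ← mul_assoc, hvw, smul_mul_assoc, mul_assoc, mul_smul_comm, pow_two]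
    _ = q • w ^ 2 + w * u - q⁻¹ • v ^ 2 := by
        rw [hvH, mul_add, smul_add, mul_smul_comm, smul_smul, mul_inv_cancel₀ hq, one_smul,
          pow_two w]
    _ = q • w ^ 2 + 1 := by rw [hwu]; abel

theorem linearSeq_exchange {q : K} (hq : q ≠ 0) {x y : F} (hx : x ≠ 0) (hy : y ≠ 0)
    (h : x * y = q • (y * x))
    (hind : LinearIndependent K (fun ab : ℤ × ℤ => x ^ ab.1 * y ^ ab.2)) (n : ℕ) :
    linearSeq q x y n * linearSeq q x y (n + 1) =
        q • (linearSeq q x y (n + 1) * linearSeq q x y n) ∧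
      linearSeq q x y n * linearSeq q x y (n + 2) = q • linearSeq q x y (n + 1) ^ 2 + 1 := by
  induction n with
  | zero =>
    refine ⟨h, ?_⟩
    have hyx : x * (y * (x⁻¹ * y)) = q • y ^ 2 := by
      rw [← mul_assoc, h, smul_mul_assoc, mul_assoc, mul_inv_cancel_left₀ hx, pow_two]
    simp only [linearSeq, conserved, mul_sub, mul_add, mul_smul_comm, hyx,
      mul_inv_cancel_left₀ hy, mul_inv_cancel₀ hx]
    abel
  | succ n ih =>
    exact exchange_step hq (linearSeq_ne_zero hq hx hy h hind n) ih.1 ih.2 rfl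

end Recursion

theorem linearIndependent_op_monomials {K : Type*} [Field K] {F : Type*} [DivisionRing F]
    [Algebra K F] {x y : F}
    (hind : LinearIndependent K (fun ab : ℤ × ℤ => x ^ ab.1 * y ^ ab.2)) :
    LinearIndependent K (fun ab : ℤ × ℤ => MulOpposite.op y ^ ab.1 * MulOpposite.op x ^ ab.2) := by
  have := (hind.comp Prod.swap Prod.swap_injective).map'
    (MulOpposite.opLinearEquiv K : F ≃ₗ[K] Fᵐᵒᵖ).toLinearMap (LinearEquiv.ker _)
  exact this

end QuantumKronecker

/-- In the skew field of fractions `F` of the quantum torus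
`ℤ[q^{±1/2}]⟨X₁^{±1}, X₂^{±1} : X₁X₂ = qX₂X₁⟩` (abstracted: `F` is a division
ring, algebra over the central base field `K` containing `q`, generated by
`q`-commuting elements `x₁, x₂` whose monomials `x₁^a x₂^b` are linearly
independent over `K`), the sequence `(X_m)_{m ∈ ℤ}` defined by the initial
values `X₁, X₂` and the recursion `X_{m-1} X_{m+1} = q X_m² + 1` is
well-defined: every `X_m` exists and is nonzero, so the recursion can be
inverted in both directions. -/
theorem kronecker_quantum_cluster_sequence_well_defined
    {K : Type*} [Field K] {F : Type*} [DivisionRing F] [Algebra K F]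
    (q : K) (hq : q ≠ 0) (x1 x2 : F) (hx1 : x1 ≠ 0) (hx2 : x2 ≠ 0)
    (hrel : x1 * x2 = q • (x2 * x1))
    (hind : LinearIndependent K (fun ab : ℤ × ℤ => x1 ^ ab.1 * x2 ^ ab.2)) :
    ∃ X : ℤ → F, X 1 = x1 ∧ X 2 = x2 ∧ (∀ m : ℤ, X m ≠ 0) ∧
      ∀ m : ℤ, X (m - 1) * X (m + 1) = q • (X m) ^ 2 + 1 := by
  have hrel' : MulOpposite.op x2 * MulOpposite.op x1 =
      q • (MulOpposite.op x1 * MulOpposite.op x2) := congrArg MulOpposite.op hrel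
  have hx1' := (MulOpposite.op_ne_zero_iff x1).2 hx1
  have hx2' := (MulOpposite.op_ne_zero_iff x2).2 hx2
  have hind' := QuantumKronecker.linearIndependent_op_monomials hind
  obtain ⟨f, rfl, rfl, hf, hfrec⟩ : ∃ f : ℕ → F, f 0 = x1 ∧ f 1 = x2 ∧ (∀ n, f n ≠ 0) ∧
      ∀ n, f n * f (n + 2) = q • f (n + 1) ^ 2 + 1 :=
    ⟨QuantumKronecker.linearSeq q x1 x2, rfl, rfl,
      QuantumKronecker.linearSeq_ne_zero hq hx1 hx2 hrel hind,
      fun n => (QuantumKronecker.linearSeq_exchange hq hx1 hx2 hrel hind n).2⟩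
  obtain ⟨g, hg0, hg1, hg, hgrec⟩ : ∃ g : ℕ → F, g 0 = f 1 ∧ g 1 = f 0 ∧ (∀ n, g n ≠ 0) ∧
      ∀ n, g (n + 2) * g n = q • g (n + 1) ^ 2 + 1 :=
    ⟨fun n => (QuantumKronecker.linearSeq q (MulOpposite.op (f 1)) (MulOpposite.op (f 0)) n).unop,
      rfl, rfl,
      fun n => (MulOpposite.unop_ne_zero_iff _).2
        (QuantumKronecker.linearSeq_ne_zero hq hx2' hx1' hrel' hind' n),
      fun n => congrArg MulOpposite.unop
        (QuantumKronecker.linearSeq_exchange hq hx2' hx1' hrel' hind' n).2⟩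
  let X : ℤ → F := fun m => if 1 ≤ m then f (m - 1).toNat else g (2 - m).toNat
  have hXf (n : ℕ) : X (n + 1) = f n := by simp [X]
  have hXg (n : ℕ) : X (2 - n) = g n := by
    match n with
    | 0 => simp [X, hg0]
    | 1 => simp [X, hg1]
    | n + 2 =>
      have hn : ¬ (1 : ℤ) ≤ 2 - ((n + 2 : ℕ) : ℤ) := by push_cast; omega
      simp only [X, if_neg hn, sub_sub_cancel, Int.toNat_natCast]
  refine ⟨X, by simpa using hXf 0, by simpa using hXf 1, fun m => ?_, fun m => ?_⟩
  · simp only [X]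
    split_ifs
    exacts [hf _, hg _]
  · obtain hm | hm : 2 ≤ m ∨ m ≤ 1 := by omega
    · obtain ⟨n, rfl⟩ := Int.le.dest hm
      have h1 : X (2 + n - 1) = f n := by rw [← hXf]; congr 1; ring
      have h2 : X (2 + n) = f (n + 1) := by rw [← hXf]; congr 1; push_cast; ring
      have h3 : X (2 + n + 1) = f (n + 2) := by rw [← hXf]; congr 1; push_cast; ring
      rw [h1, h2, h3, hfrec]
    · obtain ⟨n, hn⟩ := Int.le.dest hm
      have h1 : X (m - 1) = g (n + 2) := by rw [← hXg]; congr 1; push_cast; linarith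
      have h2 : X m = g (n + 1) := by rw [← hXg]; congr 1; push_cast; linarith
      have h3 : X (m + 1) = g n := by rw [← hXg]; congr 1; linarith
      rw [h1, h2, h3, hgrec]
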